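/- Let F be a totally real number field of degree N over ℚ with class number one. There exists a constant C > 0, depending only on F, such that for every CM-field K whose maximal totally real subfield is F and whose class number h_K is odd, and every non-principal prime ideal 𝔭 of O_K, if d denotes the order of the class of 𝔭 in the ideal class group of K, then (N𝔭)^d ≥ C·Δ_K. -/

import Mathlib

open NumberField

/-- A prime power generated by an element of a base ring with principal ideals, in a quadratic
extension of Dedekind domains, comes from a prime whose square is principal. -/
theorem isPrincipal_sq_of_pow_eq_span_algebraMap {F K : Type*} [Field F] [NumberField F] [Field K]
    [NumberField K] [Algebra F K] [IsPrincipalIdealRing (𝓞 F)] (hFK : Module.finrank F K = 2)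
    {P : Ideal (𝓞 K)} [P.IsPrime] (hP0 : P ≠ ⊥) {d : ℕ} (hd : 0 < d) {a : 𝓞 F}
    (ha : P ^ d = Ideal.span {algebraMap (𝓞 F) (𝓞 K) a}) :
    Submodule.IsPrincipal (P ^ 2) := by
  let q : Ideal (𝓞 F) := P.under (𝓞 F)
  have hq0 : q ≠ ⊥ := mt Ideal.eq_bot_of_comap_eq_bot hP0
  have haq : a ∈ q := by
    refine (Ideal.mem_comap).2 (Ideal.pow_le_self hd.ne' ?_)
    rw [ha]
    exact Ideal.mem_span_singleton_self _
  have hle : Ideal.map (algebraMap (𝓞 F) (𝓞 K)) q ∣ P ^ d := by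
    rw [ha, Ideal.dvd_iff_le, Ideal.span_singleton_le_iff_mem]
    exact Ideal.mem_map_of_mem _ haq
  have hPprime : Prime P := Ideal.prime_of_isPrime hP0 inferInstance
  have hqprime : Prime q := Ideal.prime_of_isPrime hq0 inferInstance
  obtain ⟨k, -, hk⟩ := (dvd_prime_pow hPprime _).1 hle
  rw [associated_iff_eq] at hk
  obtain ⟨s, hs⟩ := Ideal.exists_relNorm_eq_pow_of_isPrime P q
  have hrel := Ideal.relNorm_algebraMap (𝓞 K) q
  rw [hk, map_pow, hs, ← pow_mul, ← IsFractionRing.finrank_eq (𝓞 F) F (𝓞 K) K, hFK] at hrel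
  have hsk : s * k = 2 :=
    (pow_inj_of_not_isUnit hqprime.not_isUnit hqprime.ne_zero).1 hrel
  have hqK : Submodule.IsPrincipal (Ideal.map (algebraMap (𝓞 F) (𝓞 K)) q) := by
    obtain ⟨π, hπ⟩ := IsPrincipalIdealRing.principal q
    refine ⟨algebraMap (𝓞 F) (𝓞 K) π, ?_⟩
    rw [hπ]
    exact Ideal.map_span _ _ |>.trans (by simp)
  obtain ⟨b, hb⟩ := hk ▸ hqK
  refine ⟨b ^ s, ?_⟩
  rw [← hsk, mul_comm, pow_mul, hb]
  exact Ideal.span_singleton_pow _ _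

theorem isPrincipal_of_sq_of_odd_classNumber {K : Type*} [Field K] [NumberField K]
    (hodd : Odd (classNumber K)) {I : Ideal (𝓞 K)} (hI : I ≠ ⊥)
    (h : Submodule.IsPrincipal (I ^ 2)) : Submodule.IsPrincipal I := by
  have hI' : I ∈ nonZeroDivisors (Ideal (𝓞 K)) := mem_nonZeroDivisors_of_ne_zero hI
  have h2 : ClassGroup.mk0 ⟨I, hI'⟩ ^ 2 = 1 := by
    rw [← map_pow]
    exact (ClassGroup.mk0_eq_one_iff (pow_mem hI' 2)).2 h
  refine (ClassGroup.mk0_eq_one_iff hI').1 ?_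
  have hcop : Nat.Coprime 2 (classNumber K) := Nat.coprime_two_left.2 hodd
  have hdvd := Nat.dvd_gcd (orderOf_dvd_of_pow_eq_one h2)
    (orderOf_dvd_card (x := ClassGroup.mk0 ⟨I, hI'⟩))
  rw [← orderOf_eq_one_iff]
  exact Nat.dvd_one.1 (hcop ▸ hdvd)

theorem abs_norm_sub_complexConj_le {K : Type*} [Field K] [NumberField K] [IsCMField K] (x : K) :
    |Algebra.norm ℚ (x - IsCMField.complexConj K x)| ≤
      2 ^ Module.finrank ℚ K * |Algebra.norm ℚ x| := by
  have key : ((|Algebra.norm ℚ (x - IsCMField.complexConj K x)| : ℚ) : ℝ) ≤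
      2 ^ Module.finrank ℚ K * ((|Algebra.norm ℚ x| : ℚ) : ℝ) := by
    rw [← InfinitePlace.prod_eq_abs_norm, ← InfinitePlace.prod_eq_abs_norm,
      ← InfinitePlace.sum_mult_eq, ← Finset.prod_pow_eq_pow_sum, ← Finset.prod_mul_distrib]
    refine Finset.prod_le_prod (fun w _ ↦ by positivity) fun w _ ↦ ?_
    rw [← mul_pow]
    gcongr
    calc w (x - IsCMField.complexConj K x)
        ≤ w x + w (IsCMField.complexConj K x) := by
          simp_rw [← w.norm_embedding_eq, map_sub]
          exact norm_sub_le _ _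
      _ = 2 * w x := by rw [IsCMField.infinitePlace_complexConj, two_mul]
  exact_mod_cast key

section CMExtension

variable {F K : Type*} [Field F] [IsTotallyReal F] [Field K]
  [NumberField K] [IsTotallyComplex K] [Algebra F K] [Algebra.IsQuadraticExtension F K]

theorem complexConj_algebraMap_of_cmExtension [IsCMField K] (x : F) :
    IsCMField.complexConj K (algebraMap F K x) = algebraMap F K x :=
  IsCMField.complexConj_apply_eq_self K (CMExtension.equivMaximalRealSubfield F K x)

theorem complexConj_ne_self_of_notMem_range [IsCMField K] {x : K}
    (hx : x ∉ Set.range (algebraMap F K)) : IsCMField.complexConj K x ≠ x := by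
  intro h
  rw [IsCMField.complexConj_eq_self_iff] at h
  exact hx ⟨_, CMExtension.algebraMap_equivMaximalRealSubfield_symm_apply F K ⟨x, h⟩⟩

open Polynomial in
theorem aeval_derivative_minpoly_of_cmExtension [IsCMField K] {x : K}
    (hx : x ∉ Set.range (algebraMap F K)) :
    aeval x (derivative (minpoly F x)) = x - IsCMField.complexConj K x := by
  have hxint : IsIntegral F x := Algebra.IsIntegral.isIntegral x
  let τ : K →ₐ[F] K := AlgHom.mk (IsCMField.complexConj K : K →+* K)
    (fun y ↦ complexConj_algebraMap_of_cmExtension y)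
  have hdeg : (minpoly F x).natDegree = 2 := by
    refine le_antisymm ?_ ((minpoly.two_le_natDegree_iff hxint).2 hx)
    exact (minpoly.natDegree_le x).trans_eq (Algebra.IsQuadraticExtension.finrank_eq_two F K)
  have hf := (minpoly.monic hxint).as_sum
  rw [hdeg] at hf
  simp only [Finset.sum_range_succ, Finset.sum_range_zero, zero_add, pow_zero, mul_one,
    pow_one] at hf
  have h1 : aeval x (minpoly F x) = 0 := minpoly.aeval F x
  have h2 : aeval (τ x) (minpoly F x) = 0 := by rw [aeval_algHom_apply, h1, map_zero]
  have hne : τ x - x ≠ 0 := sub_ne_zero.2 (complexConj_ne_self_of_notMem_range hx)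
  change _ = x - τ x
  generalize (minpoly F x).coeff 0 = c at hf
  generalize (minpoly F x).coeff 1 = b at hf
  rw [hf] at h1 h2 ⊢
  simp only [map_add, map_mul, map_pow, aeval_X, aeval_C] at h1 h2
  have h3 : τ x + x + algebraMap F K b = 0 := by
    refine (mul_eq_zero.1 (?_ : (τ x - x) * _ = 0)).resolve_left hne
    linear_combination h2 - h1
  simp
  linear_combination h3

theorem absNorm_differentIdeal_le_of_cmExtension [NumberField F] [IsCMField K] {x : 𝓞 K}
    (hx : (x : K) ∉ Set.range (algebraMap F K)) :
    Ideal.absNorm (differentIdeal (𝓞 F) (𝓞 K)) ≤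
      2 ^ Module.finrank ℚ K * Ideal.absNorm (Ideal.span {x}) := by
  have hadj : Algebra.adjoin F {algebraMap (𝓞 K) K x} = ⊤ := by
    rw [← IntermediateField.adjoin_simple_toSubalgebra_of_isAlgebraic
      (Algebra.IsAlgebraic.isAlgebraic _)]
    have := IntermediateField.isSimpleOrder_of_finrank_prime F K
      (Algebra.IsQuadraticExtension.finrank_eq_two F K ▸ Nat.prime_two)
    rw [(eq_bot_or_eq_top (IntermediateField.adjoin F {(x : K)})).resolve_left ?_]
    · rfl
    · rw [IntermediateField.adjoin_simple_eq_bot_iff]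
      exact hx
  have hmem := aeval_derivative_mem_differentIdeal (𝓞 F) F K x hadj
  set y := Polynomial.aeval x (Polynomial.derivative (minpoly (𝓞 F) x)) with hy
  have hyK : (y : K) = x - IsCMField.complexConj K (x : K) := by
    rw [← aeval_derivative_minpoly_of_cmExtension hx,
      minpoly.isIntegrallyClosed_eq_field_fractions F K (IsIntegralClosure.isIntegral (𝓞 F) K x),
      Polynomial.derivative_map, Polynomial.aeval_map_algebraMap,
      Polynomial.aeval_algebraMap_apply]
  have hy0 : y ≠ 0 := by
    intro h
    rw [h] at hyK
    exact complexConj_ne_self_of_notMem_range hx (sub_eq_zero.1 hyK.symm).symm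
  have hnorm (z : 𝓞 K) : (Ideal.absNorm (Ideal.span {z}) : ℚ) = |Algebra.norm ℚ (z : K)| := by
    rw [Ideal.absNorm_span_singleton, Nat.cast_natAbs, Int.cast_abs, ← Algebra.coe_norm_int]
  calc Ideal.absNorm (differentIdeal (𝓞 F) (𝓞 K))
      ≤ Ideal.absNorm (Ideal.span {y}) := by
        refine Nat.le_of_dvd (Nat.pos_of_ne_zero ?_)
          (Ideal.absNorm_dvd_absNorm_of_le ((Ideal.span_singleton_le_iff_mem _).2 hmem))
        rwa [Ne, Ideal.absNorm_eq_zero_iff, Ideal.span_singleton_eq_bot]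
    _ ≤ _ := by
        have := abs_norm_sub_complexConj_le (x : K)
        rw [← hyK, ← hnorm, ← hnorm] at this
        exact_mod_cast this

end CMExtension

/-- let `F` be a totally real number field of degree `N` over `ℚ` with class
number one. There is a constant `C > 0` depending only on `F` such that for every CM-field
`K` with maximal totally real subfield `F` and odd class number, and every non-principal
prime ideal `𝔭` of `O_K`, if `d` is the order of the class of `𝔭` in the ideal class group
(i.e. the least `d > 0` with `𝔭^d` principal), then `(N𝔭)^d ≥ C·Δ_K`. -/
theorem stmt_9.{u, v} (F : Type u) [Field F] [NumberField F] (N : ℕ)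
    (hN : Module.finrank ℚ F = N)
    (hTR : ∀ φ : F →+* ℂ, ∀ z : F, (φ z).im = 0)
    (hcl : NumberField.classNumber F = 1) :
    ∃ C : ℝ, 0 < C ∧
      ∀ (K : Type v) [Field K] [NumberField K] [Algebra F K],
        Module.finrank F K = 2 →
        IsEmpty (K →+* ℝ) →
        Odd (NumberField.classNumber K) →
        ∀ 𝔭 : Ideal (𝓞 K), 𝔭.IsPrime → ¬Submodule.IsPrincipal 𝔭 →
          ∀ d : ℕ, 0 < d → Submodule.IsPrincipal (𝔭 ^ d) →
            (∀ m : ℕ, 0 < m → m < d → ¬Submodule.IsPrincipal (𝔭 ^ m)) →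
            C * ((NumberField.discr K).natAbs : ℝ) ≤ (Ideal.absNorm 𝔭 : ℝ) ^ d := by
  have hpir : IsPrincipalIdealRing (𝓞 F) := classNumber_eq_one_iff.1 hcl
  have hreal : IsTotallyReal F := ⟨fun v ↦ by
    rw [InfinitePlace.isReal_iff, ComplexEmbedding.isReal_iff]
    ext z
    exact Complex.conj_eq_iff_im.2 (hTR _ z)⟩
  have hD : 0 < ((discr F).natAbs : ℝ) := by exact_mod_cast Int.natAbs_pos.2 (discr_ne_zero F)
  refine ⟨(2 ^ (N * 2) * ((discr F).natAbs : ℝ) ^ 2)⁻¹, by positivity, ?_⟩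
  intro K _ _ _ hFK hemp hodd P hP hnp d hd hpd _
  have hcx : IsTotallyComplex K := ⟨fun v ↦ InfinitePlace.not_isReal_iff_isComplex.1
    fun hv ↦ hemp.false (InfinitePlace.embedding_of_isReal hv)⟩
  have hquad : Algebra.IsQuadraticExtension F K := ⟨hFK⟩
  have hCM : IsCMField K := IsCMField.ofCMExtension F K
  have hP0 : P ≠ ⊥ := by
    rintro rfl
    exact hnp inferInstance
  obtain ⟨a, ha⟩ := hpd
  replace ha : P ^ d = Ideal.span {a} := ha
  have haF : (a : K) ∉ Set.range (algebraMap F K) := by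
    rintro ⟨b, hb⟩
    have hbint : IsIntegral ℤ b := by
      rw [← isIntegral_algebraMap_iff (algebraMap F K).injective, hb]
      exact a.isIntegral_coe
    have hab : algebraMap (𝓞 F) (𝓞 K) ⟨b, hbint⟩ = a := by
      ext
      exact hb
    rw [← hab] at ha
    exact hnp (isPrincipal_of_sq_of_odd_classNumber hodd hP0
      (isPrincipal_sq_of_pow_eq_span_algebraMap hFK hP0 hd ha))
  have hdiff := absNorm_differentIdeal_le_of_cmExtension haF
  rw [← Module.finrank_mul_finrank ℚ F K, hN, hFK, ← ha, map_pow] at hdiff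
  rw [inv_mul_le_iff₀ (by positivity),
    natAbs_discr_eq_absNorm_differentIdeal_mul_natAbs_discr_pow F (𝓞 F) K (𝓞 K), hFK]
  have hdiff' : (Ideal.absNorm (differentIdeal (𝓞 F) (𝓞 K)) : ℝ) ≤
      2 ^ (N * 2) * (Ideal.absNorm P : ℝ) ^ d := by exact_mod_cast hdiff
  push_cast
  nlinarith [mul_le_mul_of_nonneg_right hdiff' (sq_nonneg ((discr F).natAbs : ℝ))]
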